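/- arXiv:1108.5288 — 2 statements merged into one kernel-verified Lean document; each statement's English description precedes it below -/
import Mathlib

section
/- Let 𝒞 be the class of functions F : {0,1}^n → ℝ≥0 (of all arities) such that for every pinning G of F, the function G⋆ defined by G⋆(x) = G(x)·G(1−x₁,…,1−x_k) has all Fourier coefficients nonnegative. Then the pps_ω-definable functional clone generated by the binary log-supermodular functions satisfies ⟨LSM₂⟩_ω ⊆ 𝒞. -/
open scoped NNReal BigOperators

/-- Functions of arity `n` on the Boolean domain with values in `R`. -/
abbrev FnOn (R : Type) (n : ℕ) : Type := (Fin n → Bool) → R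

/-- Functions of all arities on the Boolean domain with values in `R`. -/
abbrev Fn (R : Type) : Type := Σ n : ℕ, FnOn R n

/-- The binary equality function: `EQ(x,x) = 1`, `EQ(x,y) = 0` for `x ≠ y`. -/
def EQfn (R : Type) [CommSemiring R] : Fn R :=
  ⟨2, fun x => if x 0 = x 1 then 1 else 0⟩

/-- `F` (of arity `n`) is representable by a pps-formula over `𝓕`: there are `m` bound
variables and `s` atomic formulas, the `j`-th atomic formula applying `G j ∈ 𝓕` to a
scope `σ j` of (possibly repeated) variables among the `n + m` variables; `F x` is the
sum over all Boolean assignments of the bound variables of the product of the values of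
the atomic formulas. -/
def PpsRep (R : Type) [CommSemiring R] (𝓕 : Set (Fn R)) {n : ℕ} (F : FnOn R n) : Prop :=
  ∃ (m s : ℕ) (G : Fin s → Fn R) (σ : (j : Fin s) → Fin (G j).1 → Fin (n + m)),
    (∀ j, G j ∈ 𝓕) ∧
    ∀ x : Fin n → Bool,
      F x = ∑ y : Fin m → Bool, ∏ j : Fin s, (G j).2 (fun i => Fin.append x y (σ j i))

/-- The functional clone `⟨𝓕⟩` generated by `𝓕`: all functions representable by a
pps-formula over `𝓕 ∪ {EQ}`. -/
def Clone (R : Type) [CommSemiring R] (𝓕 : Set (Fn R)) : Set (Fn R) :=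
  {F | PpsRep R (𝓕 ∪ {EQfn R}) F.2}

/-- The pps_ω-definable functional clone `⟨𝓕⟩_ω`: all functions `F` such that for some
finite `S ⊆ 𝓕 ∪ {EQ}` and every `ε > 0`, some function of the same arity representable
by a pps-formula over `S` is within `ε` of `F` in the sup norm. -/
def CloneOmega (R : Type) [CommSemiring R] [MetricSpace R] (𝓕 : Set (Fn R)) :
    Set (Fn R) :=
  {F | ∃ S : Set (Fn R), S ⊆ 𝓕 ∪ {EQfn R} ∧ S.Finite ∧
    ∀ ε : ℝ, 0 < ε → ∃ Fhat : FnOn R F.1, PpsRep R S Fhat ∧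
      ∀ x : Fin F.1 → Bool, dist (Fhat x) (F.2 x) < ε}

/-- A nonnegative function on `{0,1}^n` is log-supermodular (lsm) if
`F(x ∨ y) · F(x ∧ y) ≥ F(x) · F(y)` for all `x, y`, with `∨, ∧` componentwise. -/
def IsLSM {n : ℕ} (F : FnOn ℝ≥0 n) : Prop :=
  ∀ x y : Fin n → Bool, F x * F y ≤ F (x ⊔ y) * F (x ⊓ y)

/-- `LSM_k`: the log-supermodular functions of arity `k`. -/
def LSMk (k : ℕ) : Set (Fn ℝ≥0) := {F | F.1 = k ∧ IsLSM F.2}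

/-- The Fourier transform of `F : {0,1}^n → ℝ`:
`F̂(y) = 2⁻ⁿ Σ_w (−1)^{|w ∧ y|} F(w)`, where `|w ∧ y|` counts the coordinates where
both `w` and `y` are `1`. -/
noncomputable def bfourier {n : ℕ} (F : (Fin n → Bool) → ℝ) : (Fin n → Bool) → ℝ :=
  fun y => (2 ^ n : ℝ)⁻¹ *
    ∑ w : Fin n → Bool,
      (-1 : ℝ) ^ (Finset.univ.filter fun i => w i = true ∧ y i = true).card * F w

/-- `G⋆(x) = G(x) · G(1 − x₁, …, 1 − x_k)`, as a real-valued function. -/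
noncomputable def starFn {k : ℕ} (G : FnOn ℝ≥0 k) : (Fin k → Bool) → ℝ :=
  fun x => (G x : ℝ) * (G (fun i => !(x i)) : ℝ)

/-- `G` (of arity `k`) is a pinning of `F` (of arity `n`): some subset of the arguments
of `F` is fixed to constants `c`, the remaining arguments (selected by the strictly
monotone map `e`) being the arguments of `G`. -/
def IsPinning {n k : ℕ} (F : FnOn ℝ≥0 n) (G : FnOn ℝ≥0 k) : Prop :=
  ∃ (e : Fin k → Fin n) (c : Fin n → Bool), StrictMono e ∧
    ∀ u : Fin k → Bool,
      G u = F (fun t => if h : ∃ s : Fin k, e s = t then u h.choose else c t)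

/-- `𝒞`: the class of nonnegative functions `F` such that for every pinning `G` of `F`,
all Fourier coefficients of `G⋆` are nonnegative. -/
def Cclass : Set (Fn ℝ≥0) :=
  {F | ∀ (k : ℕ) (G : FnOn ℝ≥0 k), IsPinning F.2 G → ∀ y, 0 ≤ bfourier (starFn G) y}

/-- The spin `±1` of a bit. -/
def bitSign (b : Bool) : ℝ := if b then -1 else 1

lemma bitSign_not (b : Bool) : bitSign (!b) = -bitSign b := by
  cases b <;> simp [bitSign]

/-- The functions `z ↦ c z * χ z`, where `c ≥ 0` depends only on the coordinates outside `D`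
and `χ` is a product of spins of coordinates in `D`. -/
def twistedNonneg {V : Type*} [Fintype V] (D : Set V) : Submonoid ((V → Bool) → ℝ) where
  carrier := {K | ∃ (c : (V → Bool) → ℝ) (e : V → ℕ), (∀ z, 0 ≤ c z) ∧ DependsOn c Dᶜ ∧
    (∀ a ∉ D, e a = 0) ∧ K = fun z => c z * ∏ a, bitSign (z a) ^ e a}
  one_mem' := ⟨1, 0, fun _ => zero_le_one, fun _ _ _ => rfl, fun _ _ => rfl, by ext; simp⟩
  mul_mem' := by
    rintro _ _ ⟨c, e, hc, hcD, he, rfl⟩ ⟨c', e', hc', hcD', he', rfl⟩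
    refine ⟨c * c', e + e', fun z => mul_nonneg (hc z) (hc' z), fun x y h => ?_, fun a ha => ?_, ?_⟩
    · simp only [Pi.mul_apply, hcD h, hcD' h]
    · simp [he a ha, he' a ha]
    · ext z
      simp only [Pi.mul_apply, Pi.add_apply, pow_add, Finset.prod_mul_distrib]
      ring

/-- The sums of functions in `twistedNonneg D`: as functions of the coordinates in `D`, they
have nonnegative Fourier coefficients. -/
def twistedCone {V : Type*} [Fintype V] (D : Set V) : Subsemiring ((V → Bool) → ℝ) :=
  (twistedNonneg D).subsemiringClosure

section Cone

variable {V : Type*} [Fintype V] {D : Set V}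

lemma mem_twistedCone_of_mem {K : (V → Bool) → ℝ} (h : K ∈ twistedNonneg D) :
    K ∈ twistedCone D :=
  AddSubmonoid.subset_closure h

lemma mem_twistedCone_of_dependsOn {c : (V → Bool) → ℝ} (hc : ∀ z, 0 ≤ c z)
    (hD : DependsOn c Dᶜ) : c ∈ twistedCone D :=
  mem_twistedCone_of_mem ⟨c, 0, hc, hD, fun _ _ => rfl, by simp⟩

lemma const_mem_twistedCone {r : ℝ} (hr : 0 ≤ r) :
    (fun _ => r : (V → Bool) → ℝ) ∈ twistedCone D :=
  mem_twistedCone_of_dependsOn (fun _ => hr) (fun _ _ _ => rfl)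

lemma bitSign_mem_twistedCone {a : V} (ha : a ∈ D) :
    (fun z => bitSign (z a)) ∈ twistedCone D := by
  classical
  refine mem_twistedCone_of_mem ⟨1, Pi.single a 1, fun _ => zero_le_one, fun _ _ _ => rfl, ?_, ?_⟩
  · intro b hb
    have : b ≠ a := by rintro rfl; exact hb ha
    simp [this]
  · ext z
    rw [Finset.prod_eq_single a]
    · simp
    · intro b _ hb
      simp [hb]
    · simp

lemma sum_nonneg_of_mem_twistedNonneg [DecidableEq V] {K : (V → Bool) → ℝ}
    (h : K ∈ twistedNonneg D) :
    0 ≤ ∑ z, K z := by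
  obtain ⟨c, e, hc, hcD, he, rfl⟩ := h
  by_cases hodd : ∃ a, Odd (e a)
  · obtain ⟨a, ha⟩ := hodd
    have haD : a ∈ D := by
      by_contra hn
      simp [he a hn] at ha
    let flip : (V → Bool) → (V → Bool) := fun z => Function.update z a (!z a)
    have hflip : Function.Involutive flip := by
      intro z
      simp [flip]
    have key : ∀ z, c (flip z) * ∏ b, bitSign (flip z b) ^ e b
        = -(c z * ∏ b, bitSign (z b) ^ e b) := by
      intro z
      have h1 : c (flip z) = c z := by
        refine hcD fun b hb => ?_
        have : b ≠ a := by rintro rfl; exact hb haD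
        simp [flip, this]
      rw [h1, ← Finset.mul_prod_erase _ _ (Finset.mem_univ a),
        ← Finset.mul_prod_erase _ (fun b => bitSign (z b) ^ e b) (Finset.mem_univ a)]
      have h2 : ∏ b ∈ Finset.univ.erase a, bitSign (flip z b) ^ e b
          = ∏ b ∈ Finset.univ.erase a, bitSign (z b) ^ e b := by
        refine Finset.prod_congr rfl fun b hb => ?_
        simp [flip, Finset.ne_of_mem_erase hb]
      have h3 : bitSign (flip z a) ^ e a = -bitSign (z a) ^ e a := by
        simp [flip, bitSign_not, ha.neg_pow]
      rw [h2, h3]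
      ring
    have := Equiv.sum_comp hflip.toPerm (fun z => c z * ∏ b, bitSign (z b) ^ e b)
    simp only [Function.Involutive.coe_toPerm, key, Finset.sum_neg_distrib] at this
    linarith
  · push Not at hodd
    refine Finset.sum_nonneg fun z _ => mul_nonneg (hc z) (Finset.prod_nonneg fun a _ => ?_)
    exact (Nat.not_odd_iff_even.1 (hodd a)).pow_nonneg _

lemma sum_nonneg_of_mem_twistedCone [DecidableEq V] {K : (V → Bool) → ℝ} (h : K ∈ twistedCone D) :
    0 ≤ ∑ z, K z := by
  have h' : K ∈ AddSubmonoid.closure (twistedNonneg D : Set ((V → Bool) → ℝ)) := h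
  clear h
  induction h' using AddSubmonoid.closure_induction with
  | mem K hK => exact sum_nonneg_of_mem_twistedNonneg hK
  | zero => simp
  | add K L _ _ hK hL => simpa [Finset.sum_add_distrib] using add_nonneg hK hL

/-- `p'` is the bit `p` after flipping the coordinates in `D`, where `p` is either a coordinate
in `D` or does not depend on the coordinates in `D`. -/
def IsFlipPair (D : Set V) (p p' : (V → Bool) → Bool) : Prop :=
  (∃ a ∈ D, (∀ z, p z = z a) ∧ ∀ z, p' z = !z a) ∨ (DependsOn p Dᶜ ∧ p' = p)

lemma mul_mem_twistedCone_of_isFlipPair {g : Bool → Bool → ℝ} (hg : ∀ a b, 0 ≤ g a b)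
    (hlsm : g true false * g false true ≤ g true true * g false false)
    {p p' q q' : (V → Bool) → Bool} (hp : IsFlipPair D p p') (hq : IsFlipPair D q q') :
    (fun z => g (p z) (q z) * g (p' z) (q' z)) ∈ twistedCone D := by
  rcases hp with ⟨a, ha, hp, hp'⟩ | ⟨hp, rfl⟩ <;> rcases hq with ⟨b, hb, hq, hq'⟩ | ⟨hq, rfl⟩
  · set A := g true true * g false false
    set B := g true false * g false true
    have hA : 0 ≤ A := mul_nonneg (hg _ _) (hg _ _)
    have hB : 0 ≤ B := mul_nonneg (hg _ _) (hg _ _)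
    have key : (fun z => g (p z) (q z) * g (p' z) (q' z)) = (fun _ => (A + B) / 2)
        + (fun _ => (A - B) / 2) * ((fun z => bitSign (z a)) * fun z => bitSign (z b)) := by
      ext z
      simp only [hp, hp', hq, hq', Pi.add_apply, Pi.mul_apply]
      cases z a <;> cases z b <;> simp [bitSign, A, B] <;> ring
    rw [key]
    exact add_mem (const_mem_twistedCone (by linarith))
      (mul_mem (const_mem_twistedCone (by linarith))
        (mul_mem (bitSign_mem_twistedCone ha) (bitSign_mem_twistedCone hb)))
  · have key : (fun z => g (p z) (q' z) * g (p' z) (q' z))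
        = fun z => g true (q' z) * g false (q' z) := by
      ext z
      rw [hp, hp']
      cases z a
      · exact mul_comm _ _
      · rfl
    rw [key]
    exact mem_twistedCone_of_dependsOn (fun z => mul_nonneg (hg _ _) (hg _ _))
      (fun x y h => by simp only [hq h])
  · have key : (fun z => g (p' z) (q z) * g (p' z) (q' z))
        = fun z => g (p' z) true * g (p' z) false := by
      ext z
      rw [hq, hq']
      cases z b
      · exact mul_comm _ _
      · rfl
    rw [key]
    exact mem_twistedCone_of_dependsOn (fun z => mul_nonneg (hg _ _) (hg _ _))
      (fun x y h => by simp only [hp h])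
  · exact mem_twistedCone_of_dependsOn (fun z => mul_nonneg (hg _ _) (hg _ _))
      (fun x y h => by simp only [hp h, hq h])

lemma atom_mem_twistedCone {G : Fn ℝ≥0} (hG : G ∈ LSMk 2) {p p' : Fin G.1 → (V → Bool) → Bool}
    (hp : ∀ i, IsFlipPair D (p i) (p' i)) :
    (fun z => (G.2 (fun i => p i z) : ℝ) * (G.2 (fun i => p' i z) : ℝ)) ∈ twistedCone D := by
  obtain ⟨n, G⟩ := G
  obtain ⟨rfl, hlsm⟩ := hG
  have hfun : ∀ f : Fin 2 → Bool, f = ![f 0, f 1] := fun f => by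
    ext i; fin_cases i <;> rfl
  have key := mul_mem_twistedCone_of_isFlipPair (g := fun a b => (G ![a, b] : ℝ))
    (fun _ _ => NNReal.coe_nonneg _) (by
      have h := hlsm ![true, false] ![false, true]
      have h1 : (![true, false] ⊔ ![false, true] : Fin 2 → Bool) = ![true, true] := by decide
      have h2 : (![true, false] ⊓ ![false, true] : Fin 2 → Bool) = ![false, false] := by decide
      rw [h1, h2] at h
      exact_mod_cast h) (hp 0) (hp 1)
  convert key using 1
  ext z
  exact congrArg₂ (fun a b : ℝ≥0 => (a : ℝ) * b)
    (congrArg G (hfun _)) (congrArg G (hfun _))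

end Cone

lemma EQfn_mem_LSMk : EQfn ℝ≥0 ∈ LSMk 2 := by
  refine ⟨rfl, fun (x y : Fin 2 → Bool) => ?_⟩
  change (if x 0 = x 1 then (1 : ℝ≥0) else 0) * (if y 0 = y 1 then 1 else 0) ≤
    (if x 0 ⊔ y 0 = x 1 ⊔ y 1 then 1 else 0) * (if x 0 ⊓ y 0 = x 1 ⊓ y 1 then 1 else 0)
  by_cases hx : x 0 = x 1 <;> by_cases hy : y 0 = y 1 <;> simp [hx, hy]

/-- The extension of an assignment of the unpinned arguments by the pinned values. -/
noncomputable def pinExtend {n k : ℕ} (e : Fin k → Fin n) (c : Fin n → Bool)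
    (u : Fin k → Bool) : Fin n → Bool :=
  fun t => open Classical in if h : ∃ s : Fin k, e s = t then u h.choose else c t

lemma bfourier_sign_eq_prod {k : ℕ} (w y : Fin k → Bool) :
    (-1 : ℝ) ^ (Finset.univ.filter fun i => w i = true ∧ y i = true).card
      = ∏ i, if y i then bitSign (w i) else 1 := by
  rw [← Finset.prod_const, Finset.prod_filter]
  refine Finset.prod_congr rfl fun i _ => ?_
  cases w i <;> cases y i <;> simp [bitSign]

/-- The unpinned arguments together with the bound variables that differ between two copies. -/
def flipSet (k : ℕ) {m : ℕ} (d : Fin m → Bool) : Set (Fin k ⊕ Fin m) :=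
  {a | Sum.elim (fun _ => true) d a = true}

lemma isFlipPair_append {n m k : ℕ} (e : Fin k → Fin n) (c : Fin n → Bool) (d : Fin m → Bool)
    (t : Fin (n + m)) :
    IsFlipPair (flipSet k d)
      (fun z => Fin.append (pinExtend e c (z ∘ Sum.inl)) (z ∘ Sum.inr) t)
      (fun z => Fin.append (pinExtend e c (fun i => !z (Sum.inl i)))
        (fun i => xor (z (Sum.inr i)) (d i)) t) := by
  refine Fin.addCases (fun t => ?_) (fun t => ?_) t
  · simp only [Fin.append_left, pinExtend]
    by_cases h : ∃ s, e s = t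
    · exact Or.inl ⟨Sum.inl h.choose, by simp [flipSet], by simp [h], by simp [h]⟩
    · exact Or.inr ⟨fun x y _ => by simp [h], by simp [h]⟩
  · simp only [Fin.append_right]
    cases hd : d t
    · exact Or.inr ⟨fun x y h => h _ (by simp [flipSet, hd]), by ext z; simp⟩
    · exact Or.inl ⟨Sum.inr t, by simp [flipSet, hd], by simp, by simp⟩

lemma bfourier_pin_nonneg_of_ppsRep {S : Set (Fn ℝ≥0)} (hS : S ⊆ LSMk 2) {n k : ℕ}
    {F : FnOn ℝ≥0 n} (hF : PpsRep ℝ≥0 S F) (e : Fin k → Fin n) (c : Fin n → Bool)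
    (y : Fin k → Bool) :
    0 ≤ bfourier (starFn fun u => F (pinExtend e c u)) y := by
  obtain ⟨m, s, G, σ, hG, hF⟩ := hF
  refine mul_nonneg (by positivity) ?_
  let P : (Fin k → Bool) → (Fin m → Bool) → ℝ := fun u v =>
    ∏ j, ((G j).2 (fun i => Fin.append (pinExtend e c u) v (σ j i)) : ℝ)
  have hP : ∀ u, (F (pinExtend e c u) : ℝ) = ∑ v, P u v := by
    intro u
    rw [hF]
    push_cast
    rfl
  have hshift : ∀ (u : Fin k → Bool) (v : Fin m → Bool),
      ∑ v', P u v' = ∑ d : Fin m → Bool, P u (fun i => xor (v i) (d i)) := by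
    intro u v
    have hinv : Function.Involutive fun d : Fin m → Bool => fun i => xor (v i) (d i) := by
      intro d
      ext i
      simp
    exact (Equiv.sum_comp hinv.toPerm (P u)).symm
  have hsum : ∑ u : Fin k → Bool,
      (-1 : ℝ) ^ (Finset.univ.filter fun i => u i = true ∧ y i = true).card *
        starFn (fun u => F (pinExtend e c u)) u
      = ∑ d : Fin m → Bool, ∑ z : Fin k ⊕ Fin m → Bool,
        (∏ i, if y i then bitSign (z (Sum.inl i)) else 1) *
          (P (z ∘ Sum.inl) (z ∘ Sum.inr) *
            P (fun i => !z (Sum.inl i)) (fun i => xor (z (Sum.inr i)) (d i))) := by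
    rw [Finset.sum_comm, ← Equiv.sum_comp (Equiv.sumArrowEquivProdArrow _ _ _).symm,
      Fintype.sum_prod_type]
    refine Finset.sum_congr rfl fun u _ => ?_
    rw [bfourier_sign_eq_prod, starFn, hP, hP, Finset.sum_mul, Finset.mul_sum]
    refine Finset.sum_congr rfl fun v _ => ?_
    rw [hshift _ v, Finset.mul_sum, Finset.mul_sum]
    rfl
  rw [hsum]
  refine Finset.sum_nonneg fun d _ => sum_nonneg_of_mem_twistedCone (D := flipSet k d) ?_
  have hχ : (∏ i, fun z : Fin k ⊕ Fin m → Bool => if y i then bitSign (z (Sum.inl i)) else 1)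
      ∈ twistedCone (flipSet k d) := by
    refine prod_mem fun i _ => ?_
    cases y i
    · exact one_mem _
    · exact bitSign_mem_twistedCone (by simp [flipSet])
  have hPP := prod_mem (t := Finset.univ) fun j _ =>
    atom_mem_twistedCone (hG := hS (hG j)) fun i => isFlipPair_append e c d (σ j i)
  convert mul_mem hχ hPP using 1
  ext z
  simp only [Pi.mul_apply, Finset.prod_apply, Finset.prod_mul_distrib, P]

/-- Lemma: `⟨LSM₂⟩_ω ⊆ 𝒞`. -/
theorem cloneOmega_lsm2_subset_Cclass :
    CloneOmega ℝ≥0 (LSMk 2) ⊆ Cclass := by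
  rintro ⟨n, F⟩ ⟨S, hS, -, happrox⟩ k G ⟨e, c, -, hG⟩ y
  have hS' : S ⊆ LSMk 2 :=
    hS.trans (Set.union_subset subset_rfl (Set.singleton_subset_iff.2 EQfn_mem_LSMk))
  have hGF : G = fun u => F (pinExtend e c u) := by
    ext u
    rw [hG]
    congr!
  rw [hGF]
  have hclosed : IsClosed {H : FnOn ℝ≥0 n |
      0 ≤ bfourier (starFn fun u => H (pinExtend e c u)) y} := by
    refine isClosed_le continuous_const ?_
    unfold bfourier starFn
    fun_prop
  refine closure_minimal (s := {H | PpsRep ℝ≥0 S H})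
    (fun H hH => bfourier_pin_nonneg_of_ppsRep hS' hH e c y) hclosed (Metric.mem_closure_iff.2 ?_)
  intro ε hε
  obtain ⟨H, hH, hdist⟩ := happrox ε hε
  exact ⟨H, hH, (dist_pi_lt_iff hε).2 fun x => by rw [dist_comm]; exact hdist x⟩
end

section
/- Let EQ' be the binary function with EQ'(x,y) = 2 if x = y and EQ'(x,y) = 1 otherwise, and let ℬ₁^down denote the set of unary functions U : {0,1} → ℝ≥0 with U(1) ≤ U(0). Then: (i) NEQ ∉ ⟨EQ', ℬ₁^down⟩_ω; (ii) EQ' ∉ ⟨NEQ, ℬ₁⟩_ω; (iii) ⟨EQ', ℬ₁^down⟩_ω is strictly contained in ⟨EQ', ℬ₁⟩_ω, and ⟨EQ', ℬ₁⟩_ω = ⟨IMP, ℬ₁⟩_ω. -/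
open scoped NNReal BigOperators

/-- `IMP(x,y) = 0` if `(x,y) = (1,0)`, and `1` otherwise. -/
def IMPfn : Fn ℝ≥0 := ⟨2, fun x => if x 0 = true ∧ x 1 = false then 0 else 1⟩

/-- `NEQ(x,y) = 1` iff `x ≠ y`, else `0`. -/
def NEQfn : Fn ℝ≥0 := ⟨2, fun x => if x 0 ≠ x 1 then 1 else 0⟩

/-- `OR(x,y) = 0` if `(x,y) = (0,0)`, and `1` otherwise. -/
def ORfn : Fn ℝ≥0 := ⟨2, fun x => if x 0 = false ∧ x 1 = false then 0 else 1⟩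

/-- `ℬ₁`: the set of all unary functions `{0,1} → ℝ≥0`. -/
def unaryFns : Set (Fn ℝ≥0) := {F | F.1 = 1}

/-- `ℬ₁^down`: the unary functions `U` with `U(1) ≤ U(0)`. -/
def B1down : Set (Fn ℝ≥0) :=
  {F | ∃ U : FnOn ℝ≥0 1, U (fun _ => true) ≤ U (fun _ => false) ∧ F = ⟨1, U⟩}

/-- The permissive equality function: `EQ'(x,y) = 2` if `x = y`, else `1`. -/
def EQpfn : Fn ℝ≥0 := ⟨2, fun x => if x 0 = x 1 then 2 else 1⟩

open Topology Filter

/-! ### Formulas indexed by arbitrary finite types -/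

/-- A formula whose bound variables and atoms are indexed by arbitrary finite types, each atom
being a function together with its scope, gives a representable function. -/
lemma ppsRep_of_atoms {R : Type} [CommSemiring R] {𝓕 : Set (Fn R)} {n : ℕ} {F : FnOn R n}
    {κ J : Type} [Fintype κ] [DecidableEq κ] [Fintype J]
    (A : J → Σ G : Fn R, (Fin G.1 → Fin n ⊕ κ)) (hA : ∀ j, (A j).1 ∈ 𝓕)
    (hF : ∀ x, F x = ∑ y : κ → Bool, ∏ j, (A j).1.2 (fun i => Sum.elim x y ((A j).2 i))) :
    PpsRep R 𝓕 F := by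
  let e := Fintype.equivFin κ
  let f := Fintype.equivFin J
  refine ⟨Fintype.card κ, Fintype.card J, fun j => (A (f.symm j)).1,
    fun j i => finSumFinEquiv (Sum.map id e ((A (f.symm j)).2 i)), fun j => hA _, fun x => ?_⟩
  have append_eq (y : Fin (Fintype.card κ) → Bool) (v : Fin n ⊕ κ) :
      Fin.append x y (finSumFinEquiv (Sum.map id e v)) = Sum.elim x (y ∘ e) v := by
    cases v <;> simp
  simp only [append_eq]
  rw [hF]
  refine Fintype.sum_equiv (e.arrowCongr (Equiv.refl Bool)) _ _ fun y => ?_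
  have : (e.arrowCongr (Equiv.refl Bool)) y ∘ e = y := by ext; simp
  rw [this]
  exact Fintype.prod_equiv f _ _ fun j => by rw [f.symm_apply_apply]

/-- Every member of `𝓕` is representable over `𝓕`. -/
lemma ppsRep_of_mem {R : Type} [CommSemiring R] {𝓕 : Set (Fn R)} {G : Fn R} (hG : G ∈ 𝓕) :
    PpsRep R 𝓕 G.2 :=
  ppsRep_of_atoms (κ := Empty) (J := Unit) (fun _ => ⟨G, Sum.inl⟩) (fun _ => hG)
    fun x => by simp

lemma PpsRep.mono {R : Type} [CommSemiring R] {𝓕 𝓖 : Set (Fn R)} (h : 𝓕 ⊆ 𝓖) {n : ℕ}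
    {F : FnOn R n} (hF : PpsRep R 𝓕 F) : PpsRep R 𝓖 F := by
  obtain ⟨m, s, G, σ, hG, hF⟩ := hF
  exact ⟨m, s, G, σ, fun j => h (hG j), hF⟩

/-- Substituting representable functions for the atoms of a formula gives a representable
function. -/
lemma PpsRep.bind {R : Type} [CommSemiring R] {𝓕 : Set (Fn R)} {n m s : ℕ} {a : Fin s → ℕ}
    (σ : (j : Fin s) → Fin (a j) → Fin (n + m)) (H : (j : Fin s) → FnOn R (a j))
    (hH : ∀ j, PpsRep R 𝓕 (H j)) :
    PpsRep R 𝓕 (fun x : Fin n → Bool => ∑ y : Fin m → Bool, ∏ j,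
      H j (fun i => Fin.append x y (σ j i))) := by
  choose m' s' G τ hG hH using hH
  refine ppsRep_of_atoms (κ := Fin m ⊕ Σ j, Fin (m' j)) (J := Σ j, Fin (s' j))
    (fun j => ⟨G j.1 j.2, fun i => Fin.addCases
      (fun p => Fin.addCases Sum.inl (fun q => Sum.inr (Sum.inl q)) (σ j.1 p))
      (fun q => Sum.inr (Sum.inr ⟨j.1, q⟩)) (τ j.1 j.2 i)⟩) (fun j => hG _ _) fun x => ?_
  rw [← (Equiv.sumArrowEquivProdArrow (Fin m) (Σ j, Fin (m' j)) Bool).symm.sum_comp,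
    Fintype.sum_prod_type]
  refine Finset.sum_congr rfl fun y _ => ?_
  simp only [hH]
  rw [Fintype.prod_sum, ← (Equiv.piCurry fun (j : Fin s) (_ : Fin (m' j)) => Bool).sum_comp]
  refine Finset.sum_congr rfl fun z _ => ?_
  rw [Fintype.prod_sigma]
  refine Finset.prod_congr rfl fun j _ => Finset.prod_congr rfl fun l _ => ?_
  refine congrArg (G j l).2 (funext fun i => ?_)
  generalize τ j l i = v
  induction v using Fin.addCases with
  | left p =>
    simp only [Fin.append_left, Fin.addCases_left]
    generalize σ j p = w
    induction w using Fin.addCases <;> simp [Equiv.sumArrowEquivProdArrow]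
  | right q => simp [Equiv.sumArrowEquivProdArrow, Sigma.curry]

/-! ### The closure operator `CloneOmega` -/

lemma mem_cloneOmega_iff {𝓕 : Set (Fn ℝ≥0)} {F : Fn ℝ≥0} :
    F ∈ CloneOmega ℝ≥0 𝓕 ↔ ∃ S ⊆ 𝓕 ∪ {EQfn ℝ≥0}, S.Finite ∧
      F.2 ∈ closure {H : FnOn ℝ≥0 F.1 | PpsRep ℝ≥0 S H} := by
  simp only [CloneOmega, Set.mem_ofPred_eq, Metric.mem_closure_iff]
  refine exists_congr fun S => and_congr_right fun _ => and_congr_right fun _ =>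
    forall_congr' fun ε => forall_congr' fun hε => exists_congr fun H => and_congr_right fun _ => ?_
  rw [dist_comm, dist_pi_lt_iff hε]

lemma subset_cloneOmega (𝓕 : Set (Fn ℝ≥0)) : 𝓕 ∪ {EQfn ℝ≥0} ⊆ CloneOmega ℝ≥0 𝓕 := fun G hG =>
  mem_cloneOmega_iff.2 ⟨{G}, by simpa using hG, Set.finite_singleton _,
    subset_closure (ppsRep_of_mem rfl)⟩

lemma cloneOmega_mono {𝓕 𝓖 : Set (Fn ℝ≥0)} (h : 𝓕 ⊆ 𝓖) :
    CloneOmega ℝ≥0 𝓕 ⊆ CloneOmega ℝ≥0 𝓖 := by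
  rintro F ⟨S, hS, hF⟩
  exact ⟨S, hS.trans (Set.union_subset_union_left _ h), hF⟩

lemma cloneOmega_subset_of_subset {𝓕 𝓖 : Set (Fn ℝ≥0)} (h : 𝓖 ⊆ CloneOmega ℝ≥0 𝓕) :
    CloneOmega ℝ≥0 𝓖 ⊆ CloneOmega ℝ≥0 𝓕 := by
  intro F hF
  obtain ⟨S, hS, hfin, hF⟩ := mem_cloneOmega_iff.1 hF
  have hS' : ∀ G ∈ S, G ∈ CloneOmega ℝ≥0 𝓕 := fun G hG => (hS hG).elim (fun hG => h hG)
    fun hG => subset_cloneOmega 𝓕 (Or.inr hG)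
  simp only [mem_cloneOmega_iff] at hS'
  choose! T hT hTfin hTcl using hS'
  refine mem_cloneOmega_iff.2 ⟨⋃ G ∈ S, T G, Set.iUnion₂_subset hT, hfin.biUnion hTfin,
    closure_minimal ?_ isClosed_closure hF⟩
  rintro H ⟨m, s, G, σ, hG, hH⟩
  let Φ : ((j : Fin s) → FnOn ℝ≥0 (G j).1) → FnOn ℝ≥0 F.1 := fun K x =>
    ∑ y : Fin m → Bool, ∏ j, K j (fun i => Fin.append x y (σ j i))
  have hΦ : Continuous Φ := by fun_prop
  have hHΦ : H = Φ fun j => (G j).2 := funext hH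
  rw [hHΦ]
  have hmem : (fun j => (G j).2) ∈ closure (Set.univ.pi fun j =>
      {K : FnOn ℝ≥0 (G j).1 | PpsRep ℝ≥0 (⋃ G ∈ S, T G) K}) := by
    rw [closure_pi_set]
    exact fun j _ => closure_mono
      (fun K hK => hK.mono (Set.subset_biUnion_of_mem (hG j))) (hTcl _ (hG j))
  refine closure_mono ?_ (mem_closure_image hΦ.continuousAt hmem)
  rintro _ ⟨K, hK, rfl⟩
  exact PpsRep.bind σ K fun j => hK j trivial

/-- A closed property of functions of a given arity shared by all functions representable over
`𝓕 ∪ {EQ}` holds throughout `CloneOmega 𝓕`. -/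
lemma cloneOmega_induction {𝓕 : Set (Fn ℝ≥0)} {n : ℕ} {P : FnOn ℝ≥0 n → Prop}
    (hP : IsClosed {F | P F}) (h : ∀ F : FnOn ℝ≥0 n, PpsRep ℝ≥0 (𝓕 ∪ {EQfn ℝ≥0}) F → P F)
    {F : FnOn ℝ≥0 n} (hF : (⟨n, F⟩ : Fn ℝ≥0) ∈ CloneOmega ℝ≥0 𝓕) : P F := by
  obtain ⟨S, hS, -, hF⟩ := mem_cloneOmega_iff.1 hF
  exact closure_minimal (fun H hH => h H (hH.mono hS)) hP hF

/-! ### Functions with nonnegative Fourier coefficients -/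

/-- The sign `±1` of a Boolean value. -/
def boolSign (b : Bool) : ℝ := if b then -1 else 1

/-- The real functions on the Boolean cube that are polynomials with nonnegative coefficients in
the signs of the coordinates. -/
def signCone (ι : Type) : Subalgebra ℝ≥0 ((ι → Bool) → ℝ) :=
  Algebra.adjoin ℝ≥0 (Set.range fun i x => boolSign (x i))

lemma boolSign_mem_signCone {ι : Type} (i : ι) : (fun x => boolSign (x i)) ∈ signCone ι :=
  Algebra.subset_adjoin ⟨i, rfl⟩

lemma sum_nonneg_of_mem_signCone {ι : Type} [Fintype ι] [DecidableEq ι] {f : (ι → Bool) → ℝ}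
    (hf : f ∈ signCone ι) : 0 ≤ ∑ x, f x := by
  have hf' : f ∈ Submodule.span ℝ≥0 (Submonoid.closure
      (Set.range fun (i : ι) (x : ι → Bool) => boolSign (x i)) : Set ((ι → Bool) → ℝ)) := by
    rw [← Algebra.adjoin_eq_span]
    exact hf
  clear hf
  induction hf' using Submodule.span_induction with
  | mem g hg =>
    have : ∃ k : ι → ℕ, g = fun x => ∏ i, boolSign (x i) ^ k i := by
      induction hg using Submonoid.closure_induction with
      | mem g hg =>
        obtain ⟨i, rfl⟩ := hg
        refine ⟨Pi.single i 1, funext fun x => ?_⟩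
        simp [Pi.single_apply, pow_ite]
      | one => exact ⟨0, by ext; simp⟩
      | mul g g' _ _ hg hg' =>
        obtain ⟨k, rfl⟩ := hg
        obtain ⟨k', rfl⟩ := hg'
        exact ⟨k + k', by ext; simp [pow_add, Finset.prod_mul_distrib]⟩
    obtain ⟨k, rfl⟩ := this
    rw [← Fintype.prod_sum fun i b => boolSign b ^ k i]
    refine Finset.prod_nonneg fun i _ => ?_
    rcases neg_one_pow_eq_or ℝ (k i) with h | h <;> simp [boolSign, h]
  | zero => simp
  | add g g' _ _ ih ih' =>
    simpa [Finset.sum_add_distrib] using add_nonneg ih ih'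
  | smul a g _ ih =>
    simpa [← Finset.mul_sum, NNReal.smul_def] using mul_nonneg a.2 ih

lemma atom_mem_signCone {G : Fn ℝ≥0} (hG : G ∈ ({EQpfn} ∪ B1down) ∪ {EQfn ℝ≥0}) {ι : Type}
    (σ : Fin G.1 → ι) : (fun x => (G.2 (fun i => x (σ i)) : ℝ)) ∈ signCone ι := by
  rcases hG with (rfl | ⟨U, hU, rfl⟩) | rfl
  · convert add_mem ((signCone ι).smul_mem (one_mem _) (3 / 2)) ((signCone ι).smul_mem
      (mul_mem (boolSign_mem_signCone (σ (0 : Fin 2))) (boolSign_mem_signCone (σ (1 : Fin 2))))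
      (1 / 2)) using 1
    funext x
    change ((if x (σ (0 : Fin 2)) = x (σ (1 : Fin 2)) then (2 : ℝ≥0) else 1 : ℝ≥0) : ℝ) = _
    simp only [Pi.add_apply, Pi.smul_apply, Pi.mul_apply, Pi.one_apply, boolSign,
      NNReal.smul_def]
    cases x (σ (0 : Fin 2)) <;> cases x (σ (1 : Fin 2)) <;> norm_num
  · convert add_mem ((signCone ι).smul_mem (one_mem _) ((U (fun _ => false) + U (fun _ => true)) / 2))
      ((signCone ι).smul_mem (boolSign_mem_signCone (σ (0 : Fin 1)))
        ((U (fun _ => false) - U (fun _ => true)) / 2)) using 1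
    funext x
    have hx : (fun i => x (σ i)) = fun _ : Fin 1 => x (σ (0 : Fin 1)) := by
      funext i
      rw [Subsingleton.elim i (0 : Fin 1)]
    change ((U (fun i => x (σ i)) : ℝ≥0) : ℝ) = _
    rw [hx]
    simp only [Pi.add_apply, Pi.smul_apply, Pi.one_apply, boolSign, NNReal.smul_def]
    cases x (σ (0 : Fin 1)) <;> simp [NNReal.coe_sub hU] <;> ring
  · convert add_mem ((signCone ι).smul_mem (one_mem _) (1 / 2)) ((signCone ι).smul_mem
      (mul_mem (boolSign_mem_signCone (σ (0 : Fin 2))) (boolSign_mem_signCone (σ (1 : Fin 2))))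
      (1 / 2)) using 1
    funext x
    change ((if x (σ (0 : Fin 2)) = x (σ (1 : Fin 2)) then (1 : ℝ≥0) else 0 : ℝ≥0) : ℝ) = _
    simp only [Pi.add_apply, Pi.smul_apply, Pi.mul_apply, Pi.one_apply, boolSign,
      NNReal.smul_def]
    cases x (σ (0 : Fin 2)) <;> cases x (σ (1 : Fin 2)) <;> norm_num

/-- The top Fourier coefficient of a function in `⟨EQ', ℬ₁^down⟩_ω` is nonnegative. -/
lemma fourier_nonneg {n : ℕ} {F : FnOn ℝ≥0 n}
    (hF : (⟨n, F⟩ : Fn ℝ≥0) ∈ CloneOmega ℝ≥0 ({EQpfn} ∪ B1down)) :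
    0 ≤ ∑ x, (∏ i, boolSign (x i)) * (F x : ℝ) := by
  refine cloneOmega_induction (P := fun F => 0 ≤ ∑ x, (∏ i, boolSign (x i)) * (F x : ℝ))
    (isClosed_le continuous_const (by fun_prop)) ?_ hF
  rintro F ⟨m, s, G, σ, hG, hF⟩
  have hmem : ((∏ i : Fin n, fun z : Fin (n + m) → Bool => boolSign (z (Fin.castAdd m i))) *
      ∏ j, fun z => ((G j).2 (fun i => z (σ j i)) : ℝ)) ∈ signCone (Fin (n + m)) :=
    mul_mem (prod_mem fun i _ => boolSign_mem_signCone _)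
      (prod_mem fun j _ => atom_mem_signCone (hG j) (σ j))
  refine (sum_nonneg_of_mem_signCone hmem).trans_eq ?_
  rw [← (Fin.appendEquiv n m).sum_comp, Fintype.sum_prod_type]
  refine Finset.sum_congr rfl fun x _ => ?_
  rw [hF, NNReal.coe_sum, Finset.mul_sum]
  refine Finset.sum_congr rfl fun y _ => ?_
  simp [Fin.appendEquiv, NNReal.coe_prod]

lemma NEQfn_notMem : NEQfn ∉ CloneOmega ℝ≥0 ({EQpfn} ∪ B1down) := by
  intro h
  have := fourier_nonneg h
  rw [← (finTwoArrowEquiv Bool).symm.sum_comp, Fintype.sum_prod_type] at this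
  norm_num [finTwoArrowEquiv, boolSign] at this

/-- The unary function that is `1` at `true` and `0` at `false`. -/
def pinTrue : Fn ℝ≥0 := ⟨1, fun x => if x 0 then 1 else 0⟩

lemma pinTrue_notMem : pinTrue ∉ CloneOmega ℝ≥0 ({EQpfn} ∪ B1down) := by
  intro h
  have := fourier_nonneg h
  rw [← (Equiv.funUnique (Fin 1) Bool).symm.sum_comp] at this
  norm_num [boolSign] at this

/-! ### Functions supported on an antipodal pair -/

/-- Any two points of the support of `G` are equal or antipodal. -/
def AntipodalSupport (G : Fn ℝ≥0) : Prop :=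
  ∀ x y, G.2 x ≠ 0 → G.2 y ≠ 0 → ∀ p q, (x p ^^ y p) = (x q ^^ y q)

lemma antipodalSupport_of_mem {G : Fn ℝ≥0} (hG : G ∈ ({NEQfn} ∪ unaryFns) ∪ {EQfn ℝ≥0}) :
    AntipodalSupport G := by
  rcases hG with (rfl | hG) | rfl
  · intro x y hx hy
    change Fin 2 → Bool at x y
    change (if x 0 ≠ x 1 then (1 : ℝ≥0) else 0) ≠ 0 at hx
    change (if y 0 ≠ y 1 then (1 : ℝ≥0) else 0) ≠ 0 at hy
    change ∀ p q : Fin 2, _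
    simp only [Fin.forall_fin_two]
    revert hx hy
    cases x 0 <;> cases x 1 <;> cases y 0 <;> cases y 1 <;> simp
  · obtain ⟨n, U⟩ := G
    obtain rfl : n = 1 := hG
    intro x y _ _ p q
    rw [Subsingleton.elim (α := Fin 1) p q]
  · intro x y hx hy
    change Fin 2 → Bool at x y
    change (if x 0 = x 1 then (1 : ℝ≥0) else 0) ≠ 0 at hx
    change (if y 0 = y 1 then (1 : ℝ≥0) else 0) ≠ 0 at hy
    change ∀ p q : Fin 2, _
    simp only [Fin.forall_fin_two]
    revert hx hy
    cases x 0 <;> cases x 1 <;> cases y 0 <;> cases y 1 <;> simp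

open Classical in
/-- A binary function represented by a formula whose atoms have antipodal support either has rank
one or vanishes at one of `(0,0)` and `(0,1)`, according to whether the two free variables lie in
different components of the formula. -/
lemma PpsRep.rank_one_or_vanish {𝓕 : Set (Fn ℝ≥0)} (h𝓕 : ∀ G ∈ 𝓕, AntipodalSupport G)
    {F : FnOn ℝ≥0 2} (hF : PpsRep ℝ≥0 𝓕 F) :
    F ![false, false] * F ![true, true] = F ![true, false] * F ![false, true] ∨
      F ![false, false] * F ![false, true] = 0 := by
  obtain ⟨m, s, G, σ, hG, hF⟩ := hF
  let W : (Fin (2 + m) → Bool) → ℝ≥0 := fun z => ∏ j, (G j).2 (fun i => z (σ j i))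
  replace hF : ∀ x, F x = ∑ y, W (Fin.append x y) := hF
  let r : Fin (2 + m) → Fin (2 + m) → Prop := fun u v => ∃ j p q, σ j p = u ∧ σ j q = v
  let A : Set (Fin (2 + m)) := {v | Relation.EqvGen r (Fin.castAdd m 0) v}
  by_cases hA : Fin.castAdd m 1 ∈ A
  · right
    have xor_eq {X Y : Fin (2 + m) → Bool} (hX : W X ≠ 0) (hY : W Y ≠ 0) {u v : Fin (2 + m)}
        (huv : Relation.EqvGen r u v) : (X u ^^ Y u) = (X v ^^ Y v) := by
      induction huv with
      | rel u v h =>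
        obtain ⟨j, p, q, rfl, rfl⟩ := h
        exact h𝓕 _ (hG j) _ _ (Finset.prod_ne_zero_iff.1 hX j (Finset.mem_univ _))
          (Finset.prod_ne_zero_iff.1 hY j (Finset.mem_univ _)) p q
      | refl => rfl
      | symm _ _ _ ih => exact ih.symm
      | trans _ _ _ _ _ ih ih' => exact ih.trans ih'
    by_contra hne
    rw [mul_eq_zero, not_or, hF, hF] at hne
    obtain ⟨y, -, hy⟩ := Finset.exists_ne_zero_of_sum_ne_zero hne.1
    obtain ⟨y', -, hy'⟩ := Finset.exists_ne_zero_of_sum_ne_zero hne.2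
    have hxor := xor_eq hy hy' hA
    simp only [Fin.append_left] at hxor
    simp at hxor
  · left
    have swap (X Y : Fin (2 + m) → Bool) :
        W X * W Y = W (A.piecewise Y X) * W (A.piecewise X Y) := by
      simp only [W, ← Finset.prod_mul_distrib]
      refine Finset.prod_congr rfl fun j _ => ?_
      by_cases hj : ∃ p, σ j p ∈ A
      · obtain ⟨p, hp⟩ := hj
        have hall : ∀ i, σ j i ∈ A := fun i => hp.trans _ _ _ (.rel _ _ ⟨j, p, i, rfl, rfl⟩)
        simp [Set.piecewise, hall, mul_comm]
      · push Not at hj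
        simp [Set.piecewise, hj]
    have h0 : Fin.castAdd m 0 ∈ A := Relation.EqvGen.refl _
    let B : Set (Fin m) := {i | Fin.natAdd 2 i ∈ A}
    let e : ((Fin m → Bool) × (Fin m → Bool)) ≃ ((Fin m → Bool) × (Fin m → Bool)) :=
      Function.Involutive.toPerm (fun y => (B.piecewise y.2 y.1, B.piecewise y.1 y.2)) fun y => by
        ext i <;> by_cases hi : i ∈ B <;> simp [hi]
    have glue (a b a' b' : Bool) (y y' : Fin m → Bool) :
        A.piecewise (Fin.append ![a', b'] y') (Fin.append ![a, b] y) =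
          Fin.append ![a', b] (B.piecewise y' y) := by
      funext v
      induction v using Fin.addCases with
      | left i => fin_cases i <;> simp_all [Set.piecewise]
      | right i => simp [Set.piecewise, B]
    simp only [hF, Fintype.sum_mul_sum]
    rw [← Fintype.sum_prod_type', ← Fintype.sum_prod_type']
    refine Fintype.sum_equiv e _ _ fun y => ?_
    rw [swap, glue, glue]
    rfl

lemma EQpfn_notMem : EQpfn ∉ CloneOmega ℝ≥0 ({NEQfn} ∪ unaryFns) := by
  intro h
  have := cloneOmega_induction (P := fun F : FnOn ℝ≥0 2 =>
      F ![false, false] * F ![true, true] = F ![true, false] * F ![false, true] ∨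
        F ![false, false] * F ![false, true] = 0)
    ((isClosed_eq (by fun_prop) (by fun_prop)).union (isClosed_eq (by fun_prop) (by fun_prop)))
    (fun F hF => hF.rank_one_or_vanish fun G => antipodalSupport_of_mem) h
  norm_num at this

/-! ### Interdefinability of `EQ'` and `IMP` -/

/-- The unary function with values `a` at `false` and `b` at `true`. -/
def unaryFn (a b : ℝ≥0) : Fn ℝ≥0 := ⟨1, fun x => if x 0 then b else a⟩

lemma IMPfn_mem : IMPfn ∈ CloneOmega ℝ≥0 ({EQpfn} ∪ unaryFns) := by
  refine mem_cloneOmega_iff.2 ⟨{EQpfn, unaryFn 1 (1 / 2), unaryFn (1 / 2) 1}, ?_,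
    Set.toFinite _, ?_⟩
  · rintro _ (rfl | rfl | rfl)
    exacts [Or.inl (Or.inl rfl), Or.inl (Or.inr rfl), Or.inl (Or.inr rfl)]
  let c : FnOn ℝ≥0 2 := fun x => if x 0 = true ∧ x 1 = false then 1 / 4 else 1
  have hc : Tendsto (fun (k : ℕ) x => c x ^ k) atTop (𝓝 IMPfn.2) := by
    refine tendsto_pi_nhds.2 fun x => ?_
    change Tendsto _ _ (𝓝 (if x (0 : Fin 2) = true ∧ x (1 : Fin 2) = false then 0 else 1))
    by_cases hx : x (0 : Fin 2) = true ∧ x (1 : Fin 2) = false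
    · simp only [c, if_pos hx]
      exact tendsto_pow_atTop_nhds_zero_of_lt_one (by norm_num)
        (by rw [← NNReal.coe_lt_coe]; norm_num)
    · simp only [c, if_neg hx, one_pow]
      exact tendsto_const_nhds
  refine mem_closure_of_tendsto hc (Eventually.of_forall fun k => ?_)
  let A : Fin 3 → Σ G : Fn ℝ≥0, (Fin G.1 → Fin 2 ⊕ Empty) :=
    ![⟨EQpfn, Sum.inl⟩, ⟨unaryFn 1 (1 / 2), fun _ => Sum.inl 0⟩,
      ⟨unaryFn (1 / 2) 1, fun _ => Sum.inl 1⟩]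
  refine ppsRep_of_atoms (κ := Empty) (J := Fin k × Fin 3) (fun j => A j.2) ?_ fun x => ?_
  · rintro ⟨-, j⟩
    fin_cases j <;> simp [A]
  · simp only [Finset.univ_unique, Finset.sum_singleton, Fintype.prod_prod_type,
      Finset.prod_const, Finset.card_univ, Fintype.card_fin]
    congr 1
    rw [Fin.prod_univ_three]
    change (if x (0 : Fin 2) = true ∧ x (1 : Fin 2) = false then (1 / 4 : ℝ≥0) else 1) =
      (if x (0 : Fin 2) = x (1 : Fin 2) then 2 else 1) * (if x (0 : Fin 2) then 1 / 2 else 1) *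
        (if x (1 : Fin 2) then 1 else 1 / 2)
    cases x (0 : Fin 2) <;> cases x (1 : Fin 2) <;> norm_num

lemma EQpfn_mem : EQpfn ∈ CloneOmega ℝ≥0 ({IMPfn} ∪ unaryFns) := by
  refine mem_cloneOmega_iff.2 ⟨{IMPfn, unaryFn 2 1, unaryFn 1 (1 / 2), unaryFn 1 3}, ?_,
    Set.toFinite _, subset_closure ?_⟩
  · rintro _ (rfl | rfl | rfl | rfl)
    exacts [Or.inl (Or.inl rfl), Or.inl (Or.inr rfl), Or.inl (Or.inr rfl), Or.inl (Or.inr rfl)]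
  let A : Fin 5 → Σ G : Fn ℝ≥0, (Fin G.1 → Fin 2 ⊕ Unit) :=
    ![⟨unaryFn 2 1, fun _ => Sum.inl 0⟩, ⟨unaryFn 1 (1 / 2), fun _ => Sum.inl 1⟩,
      ⟨unaryFn 1 3, fun _ => Sum.inr ()⟩,
      ⟨IMPfn, (![Sum.inr (), Sum.inl 0] : Fin 2 → Fin 2 ⊕ Unit)⟩,
      ⟨IMPfn, (![Sum.inr (), Sum.inl 1] : Fin 2 → Fin 2 ⊕ Unit)⟩]
  refine ppsRep_of_atoms A (fun j => ?_) fun x => ?_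
  · fin_cases j <;> simp [A]
  · rw [← (Equiv.funUnique Unit Bool).symm.sum_comp, Fintype.sum_bool]
    simp only [Fin.prod_univ_five]
    let t (z : Bool) : ℝ≥0 := (if x (0 : Fin 2) then 1 else 2) *
      (if x (1 : Fin 2) then 1 / 2 else 1) * (if z then 3 else 1) *
      (if z = true ∧ x (0 : Fin 2) = false then 0 else 1) *
      (if z = true ∧ x (1 : Fin 2) = false then 0 else 1)
    change (if x (0 : Fin 2) = x (1 : Fin 2) then (2 : ℝ≥0) else 1) = t true + t false
    simp only [t]
    cases x (0 : Fin 2) <;> cases x (1 : Fin 2) <;> norm_num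

lemma B1down_subset_unaryFns : B1down ⊆ unaryFns := by
  rintro _ ⟨U, -, rfl⟩
  rfl

/-- Lemma (`EQp`): (i) `NEQ ∉ ⟨EQ', ℬ₁^down⟩_ω`; (ii) `EQ' ∉ ⟨NEQ, ℬ₁⟩_ω`;
(iii) `⟨EQ', ℬ₁^down⟩_ω ⊊ ⟨EQ', ℬ₁⟩_ω = ⟨IMP, ℬ₁⟩_ω`. -/
theorem eqp_lemma :
    NEQfn ∉ CloneOmega ℝ≥0 ({EQpfn} ∪ B1down) ∧
    EQpfn ∉ CloneOmega ℝ≥0 ({NEQfn} ∪ unaryFns) ∧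
    CloneOmega ℝ≥0 ({EQpfn} ∪ B1down) ⊂ CloneOmega ℝ≥0 ({EQpfn} ∪ unaryFns) ∧
    CloneOmega ℝ≥0 ({EQpfn} ∪ unaryFns) = CloneOmega ℝ≥0 ({IMPfn} ∪ unaryFns) := by
  refine ⟨NEQfn_notMem, EQpfn_notMem, Set.ssubset_iff_exists.2
    ⟨cloneOmega_mono (Set.union_subset_union_right _ B1down_subset_unaryFns), pinTrue,
      subset_cloneOmega _ (Or.inl (Or.inr rfl)), pinTrue_notMem⟩,
    (cloneOmega_subset_of_subset ?_).antisymm (cloneOmega_subset_of_subset ?_)⟩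
  · rintro G (rfl | hG)
    exacts [EQpfn_mem, subset_cloneOmega _ (Or.inl (Or.inr hG))]
  · rintro G (rfl | hG)
    exacts [IMPfn_mem, subset_cloneOmega _ (Or.inl (Or.inr hG))]
end
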